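/- (Step (b) in the proof of Lemma 4.3.) Assume hypotheses (H0), (H2) and (H3) hold, and let K be a compact subset of W^{1,p}_0(Ω). Then for every ε > 0 there exists R*_ε = R*(K, ε) > 0 such that |∫_Ω (A(x, Ru) − A^∞(x)) |∇u|^p dx| < ε for all R ≥ R*_ε and all u ∈ K. -/

import Mathlib

open MeasureTheory Filter Set

noncomputable section

abbrev EN (N : ℕ) := EuclideanSpace ℝ (Fin N)

/-- The ambient Banach space `L^p(Ω) × L^p(Ω; ℝ^N)` in which `W^{1,p}_0(Ω)` is realized
as pairs `(u, ∇u)`. -/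
abbrev WAmbient (N : ℕ) (p : ℝ) (Ω : Set (EN N)) :=
  Lp ℝ (ENNReal.ofReal p) (volume.restrict Ω) ×
    Lp (EN N) (ENNReal.ofReal p) (volume.restrict Ω)

/-- The Sobolev space `W^{1,p}_0(Ω)`, realized as the closure, in `L^p × L^p`, of the set
of pairs `(φ, ∇φ)` with `φ` smooth and compactly supported in `Ω`. -/
def WSpace (N : ℕ) (p : ℝ) (Ω : Set (EN N)) [Fact (1 ≤ ENNReal.ofReal p)] :
    Set (WAmbient N p Ω) :=
  closure {w : WAmbient N p Ω | ∃ φ : EN N → ℝ, ContDiff ℝ (⊤ : ℕ∞) φ ∧ HasCompactSupport φ ∧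
    tsupport φ ⊆ Ω ∧ (⇑w.1 =ᵐ[volume.restrict Ω] φ) ∧
    (⇑w.2 =ᵐ[volume.restrict Ω] fun x => gradient φ x)}

/-- A Carathéodory function on `Ω × ℝ`. -/
def Caratheodory {N : ℕ} (Ω : Set (EN N)) (A : EN N → ℝ → ℝ) : Prop :=
  (∀ t : ℝ, Measurable fun x => A x t) ∧
    ∀ᵐ x ∂(volume.restrict Ω), Continuous fun t => A x t

/-- `(H0)`-type essential boundedness. -/
def H0bound {N : ℕ} (Ω : Set (EN N)) (A : EN N → ℝ → ℝ) : Prop :=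
  ∀ r > (0 : ℝ), ∃ C : ℝ, ∀ᵐ x ∂(volume.restrict Ω), ∀ t : ℝ, |t| ≤ r → |A x t| ≤ C

theorem aux_lim {α : Type*} [MeasurableSpace α] {μ : Measure α} {h : ℕ → α → ℝ} {h0 : α → ℝ}
    {g : ℕ → α → ℝ} {g0 : α → ℝ} {C : ℝ}
    (hm : ∀ n, AEStronglyMeasurable (h n) μ)
    (hb : ∀ n, ∀ x, |h n x| ≤ C)
    (hlim : ∀ᵐ x ∂μ, Tendsto (fun n => h n x) atTop (nhds (h0 x)))
    (hg : ∀ n, Integrable (g n) μ) (hg0 : Integrable g0 μ)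
    (hgl : Tendsto (fun n => ∫ x, ‖g n x - g0 x‖ ∂μ) atTop (nhds 0)) :
    Tendsto (fun n => ∫ x, h n x * g n x ∂μ) atTop (nhds (∫ x, h0 x * g0 x ∂μ)) := by
  have i1 : ∀ n, Integrable (fun x => h n x * g0 x) μ := fun n =>
    hg0.bdd_mul (hm n) (Eventually.of_forall (hb n))
  have i2 : ∀ n, Integrable (fun x => h n x * (g n x - g0 x)) μ := fun n =>
    ((hg n).sub hg0).bdd_mul (hm n) (Eventually.of_forall (hb n))
  have e : ∀ n, ∫ x, h n x * g n x ∂μ =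
      ∫ x, h n x * (g n x - g0 x) ∂μ + ∫ x, h n x * g0 x ∂μ := by
    intro n
    rw [← integral_add (i2 n) (i1 n)]
    congr 1; ext x; ring
  simp_rw [e]
  rw [← zero_add (∫ x, h0 x * g0 x ∂μ)]
  refine Tendsto.add ?_ ?_
  · have : Tendsto (fun n => C * ∫ x, ‖g n x - g0 x‖ ∂μ) atTop (nhds 0) := by
      simpa using hgl.const_mul C
    refine squeeze_zero_norm (fun n => ?_) this
    rw [← integral_const_mul]
    refine norm_integral_le_of_norm_le (((hg n).sub hg0).norm.const_mul C) ?_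
    refine Eventually.of_forall fun x => ?_
    rw [norm_mul]
    exact mul_le_mul_of_nonneg_right (hb n x) (norm_nonneg _)
  · refine tendsto_integral_of_dominated_convergence (fun x => C * ‖g0 x‖) (fun n => (i1 n).1)
      (hg0.norm.const_mul C) (fun n => Eventually.of_forall fun x => ?_) ?_
    · rw [norm_mul]
      exact mul_le_mul_of_nonneg_right (hb n x) (norm_nonneg _)
    · filter_upwards [hlim] with x hx using hx.mul_const _

theorem aux_L1 {α E : Type*} [MeasurableSpace α] {μ : Measure α} [IsFiniteMeasure μ]
    [NormedAddCommGroup E] {q : ENNReal} [Fact (1 ≤ q)] {f : ℕ → Lp E q μ} {f0 : Lp E q μ}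
    (h : Tendsto f atTop (nhds f0)) :
    Tendsto (fun n => ∫ x, ‖f n x - f0 x‖ ∂μ) atTop (nhds 0) := by
  have hq : 1 ≤ q := Fact.out
  have h1 := (Lp.tendsto_Lp_iff_tendsto_eLpNorm' f f0).1 h
  have h2 : Tendsto (fun n => eLpNorm (⇑(f n) - ⇑f0) 1 μ) atTop (nhds 0) := by
    have h3 : Tendsto (fun n => eLpNorm (⇑(f n) - ⇑f0) q μ *
        μ univ ^ (1 / (1 : ENNReal).toReal - 1 / q.toReal)) atTop (nhds 0) := by
      rw [← zero_mul (μ univ ^ (1 / (1 : ENNReal).toReal - 1 / q.toReal))]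
      refine ENNReal.Tendsto.mul_const h1 (Or.inr ?_)
      refine ENNReal.rpow_ne_top_of_nonneg ?_ (measure_ne_top _ _)
      by_cases hqt : q = ⊤
      · simp [hqt]
      have : 1 ≤ q.toReal := by
        have := ENNReal.toReal_mono hqt hq
        simpa using this
      have := inv_le_one_of_one_le₀ this
      simpa using this
    exact tendsto_of_tendsto_of_tendsto_of_le_of_le tendsto_const_nhds h3 (fun _ => zero_le)
      (fun n => eLpNorm_le_eLpNorm_mul_rpow_measure_univ hq
        ((Lp.aestronglyMeasurable _).sub (Lp.aestronglyMeasurable _)))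
  have h4 := (ENNReal.tendsto_toReal ENNReal.zero_ne_top).comp h2
  refine h4.congr fun n => ?_
  have h5 := integral_norm_eq_lintegral_enorm
    ((Lp.aestronglyMeasurable (f n)).sub (Lp.aestronglyMeasurable f0))
  simp only [Function.comp, eLpNorm_one_eq_lintegral_enorm]
  exact h5.symm

theorem aux_Lp {α E : Type*} [MeasurableSpace α] {μ : Measure α}
    [NormedAddCommGroup E] {p : ℝ} (hp : 1 < p) [Fact (1 ≤ ENNReal.ofReal p)]
    {f : ℕ → Lp E (ENNReal.ofReal p) μ} {f0 : Lp E (ENNReal.ofReal p) μ}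
    (h : Tendsto f atTop (nhds f0)) :
    Tendsto (fun n => ∫ x, ‖f n x - f0 x‖ ^ p ∂μ) atTop (nhds 0) := by
  have h1 := (Lp.tendsto_Lp_iff_tendsto_eLpNorm' f f0).1 h
  have h4 := (ENNReal.tendsto_toReal ENNReal.zero_ne_top).comp h1
  have h5 := h4.rpow_const (p := p) (Or.inr (by linarith))
  simp only [ENNReal.toReal_zero, Real.zero_rpow (show p ≠ 0 by linarith)] at h5
  refine h5.congr fun n => ?_
  have hm : MemLp (⇑(f n) - ⇑f0) (ENNReal.ofReal p) μ := (Lp.memLp _).sub (Lp.memLp _)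
  simp only [Function.comp]
  rw [hm.eLpNorm_eq_integral_rpow_norm (by simp; linarith) (by simp)]
  rw [ENNReal.toReal_ofReal (by linarith : 0 ≤ p)]
  rw [ENNReal.toReal_ofReal (by positivity), Real.rpow_inv_rpow (by positivity) (by linarith)]
  rfl

theorem aux_smooth {N : ℕ} {Ω : Set (EN N)} {φ ζ : EN N → ℝ}
    (hφ : ContDiff ℝ (⊤ : ℕ∞) φ)
    (hζ : ContDiff ℝ (⊤ : ℕ∞) ζ) (hζc : HasCompactSupport ζ) (hζs : tsupport ζ ⊆ Ω)
    (v : EN N) {δ : ℝ} (hδ : 0 < δ) :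
    |∫ x in Ω, (1 / (1 + (φ x / δ) ^ 2) * ζ x) * inner ℝ (gradient φ x) v| ≤
      δ * ∫ x, (Real.pi / 2) * ‖fderiv ℝ ζ x v‖ := by
  have hφ1 : ContDiff ℝ 1 φ := hφ.of_le (by exact_mod_cast le_top)
  have hζ1 : ContDiff ℝ 1 ζ := hζ.of_le (by exact_mod_cast le_top)
  set Φ : EN N → ℝ := fun x => δ * Real.arctan (φ x / δ) with hΦ
  have hΦ1 : ContDiff ℝ 1 Φ := by
    exact contDiff_const.mul (Real.contDiff_arctan.comp (hφ1.div_const δ))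
  have hder : ∀ x, fderiv ℝ Φ x v = 1 / (1 + (φ x / δ) ^ 2) * inner ℝ (gradient φ x) v := by
    intro x
    have hd : HasFDerivAt φ (fderiv ℝ φ x) x := (hφ1.differentiable one_ne_zero x).hasFDerivAt
    have h2 := ((hd.mul_const δ⁻¹).arctan).const_mul δ
    have h3 : HasFDerivAt Φ _ x := h2
    rw [h3.fderiv]
    have : inner ℝ (gradient φ x) v = fderiv ℝ φ x v := by
      rw [← toDual_gradient]; rfl
    rw [this]
    simp [div_eq_mul_inv]
    field_simp
  have hcf : Continuous (fun x => fderiv ℝ ζ x v) :=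
    (hζ1.continuous_fderiv one_ne_zero).clm_apply continuous_const
  have hcF : Continuous (fun x => fderiv ℝ Φ x v) :=
    (hΦ1.continuous_fderiv one_ne_zero).clm_apply continuous_const
  have hsf : HasCompactSupport (fun x => fderiv ℝ ζ x v) :=
    hζc.fderiv_apply ℝ v
  have ibp := integral_mul_fderiv_eq_neg_fderiv_mul_of_integrable (μ := (volume : Measure (EN N)))
    (f := Φ) (g := ζ) (v := v)
    ((hcF.mul hζ1.continuous).integrable_of_hasCompactSupport hζc.mul_left)
    ((hΦ1.continuous.mul hcf).integrable_of_hasCompactSupport hsf.mul_left)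
    ((hΦ1.continuous.mul hζ1.continuous).integrable_of_hasCompactSupport hζc.mul_left)
    (fun x _ => hΦ1.differentiable one_ne_zero x) (fun x _ => hζ1.differentiable one_ne_zero x)
  have e : ∫ x in Ω, (1 / (1 + (φ x / δ) ^ 2) * ζ x) * inner ℝ (gradient φ x) v =
      ∫ x, fderiv ℝ Φ x v * ζ x := by
    rw [setIntegral_eq_integral_of_forall_compl_eq_zero]
    · congr 1; ext x; rw [hder]; ring
    · intro x hx
      have : ζ x = 0 := image_eq_zero_of_notMem_tsupport fun h => hx (hζs h)
      simp [this]
  rw [e, ← abs_neg, ← ibp, ← integral_const_mul, ← Real.norm_eq_abs]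
  refine norm_integral_le_of_norm_le
    (((hcf.norm.integrable_of_hasCompactSupport hsf.norm).const_mul _).const_mul _) ?_
  refine Eventually.of_forall fun x => ?_
  rw [norm_mul, ← mul_assoc]
  refine mul_le_mul_of_nonneg_right ?_ (norm_nonneg _)
  rw [hΦ, norm_mul, Real.norm_eq_abs, abs_of_pos hδ]
  refine mul_le_mul_of_nonneg_left ?_ hδ.le
  rw [Real.norm_eq_abs, abs_le]
  exact ⟨by linarith [Real.neg_pi_div_two_lt_arctan (φ x / δ)],
    (Real.arctan_lt_pi_div_two (φ x / δ)).le⟩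

theorem aux_bound {N : ℕ} {Ω : Set (EN N)} {p : ℝ} [Fact (1 ≤ ENNReal.ofReal p)]
    [IsFiniteMeasure (volume.restrict Ω)]
    {w : WAmbient N p Ω} (hw : w ∈ WSpace N p Ω) {ζ : EN N → ℝ}
    (hζ : ContDiff ℝ (⊤ : ℕ∞) ζ) (hζc : HasCompactSupport ζ) (hζs : tsupport ζ ⊆ Ω)
    (v : EN N) {δ : ℝ} (hδ : 0 < δ) :
    |∫ x in Ω, (1 / (1 + (w.1 x / δ) ^ 2) * ζ x) * inner ℝ (w.2 x) v| ≤
      δ * ∫ x, (Real.pi / 2) * ‖fderiv ℝ ζ x v‖ := by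
  have hq : 1 ≤ ENNReal.ofReal p := Fact.out
  obtain ⟨W, hW, hWl⟩ := mem_closure_iff_seq_limit.1 hw
  have hl1 : Tendsto (fun n => (W n).1) atTop (nhds w.1) := (continuous_fst.tendsto w).comp hWl
  have hl2 : Tendsto (fun n => (W n).2) atTop (nhds w.2) := (continuous_snd.tendsto w).comp hWl
  obtain ⟨ns, hns, hae⟩ := (tendstoInMeasure_of_tendsto_Lp hl1).exists_seq_tendsto_ae
  have hl2' := aux_L1 (hl2.comp hns.tendsto_atTop)
  obtain ⟨C, hC⟩ := hζc.exists_bound_of_continuous hζ.continuous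
  have hint : ∀ f : Lp (EN N) (ENNReal.ofReal p) (volume.restrict Ω),
      Integrable (fun x => (f : EN N → EN N) x) (volume.restrict Ω) := fun f =>
    (Lp.memLp f).integrable hq
  have key := aux_lim (μ := volume.restrict Ω)
    (h := fun n x => 1 / (1 + ((W (ns n)).1 x / δ) ^ 2) * ζ x)
    (h0 := fun x => 1 / (1 + (w.1 x / δ) ^ 2) * ζ x)
    (g := fun n x => inner ℝ ((W (ns n)).2 x) v) (g0 := fun x => inner ℝ (w.2 x) v) (C := C)
    ?_ ?_ ?_ ?_ ?_ ?_
  · refine le_of_tendsto' key.abs fun n => ?_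
    obtain ⟨φ, hφ, -, -, h1, h2⟩ := hW (ns n)
    refine le_trans (le_of_eq ?_) (aux_smooth hφ hζ hζc hζs v hδ)
    congr 1
    refine integral_congr_ae ?_
    filter_upwards [h1, h2] with x hx1 hx2
    rw [hx1, hx2]
  · intro n
    have := (Lp.stronglyMeasurable (W (ns n)).1).measurable
    have h2 := hζ.continuous.measurable
    exact Measurable.aestronglyMeasurable (by fun_prop)
  · intro n x
    rw [abs_mul]
    have h1 : |1 / (1 + ((W (ns n)).1 x / δ) ^ 2)| ≤ 1 := by
      rw [abs_of_nonneg (by positivity), div_le_one (by positivity)]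
      linarith [sq_nonneg ((W (ns n)).1 x / δ)]
    calc _ ≤ 1 * |ζ x| := mul_le_mul_of_nonneg_right h1 (abs_nonneg _)
      _ ≤ C := by rw [one_mul]; exact hC x
  · filter_upwards [hae] with x hx
    have hc : Continuous (fun t : ℝ => 1 / (1 + (t / δ) ^ 2) * ζ x) := by
      refine Continuous.mul ?_ continuous_const
      exact continuous_const.div (by fun_prop) (fun t => by positivity)
    exact (hc.tendsto _).comp hx
  · exact fun n => (hint _).inner_const v
  · exact (hint _).inner_const v
  · have h3 := hl2'.mul_const ‖v‖
    rw [zero_mul] at h3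
    refine squeeze_zero (fun n => integral_nonneg fun x => norm_nonneg _) (fun n => ?_) h3
    rw [← integral_mul_const]
    refine integral_mono_of_nonneg (Eventually.of_forall fun x => norm_nonneg _)
      (((hint _).sub (hint _)).norm.mul_const _) (Eventually.of_forall fun x => ?_)
    simp only [← inner_sub_left]
    exact norm_inner_le_norm _ _

theorem aux_zero {N : ℕ} {Ω : Set (EN N)} {p : ℝ} [Fact (1 ≤ ENNReal.ofReal p)]
    [IsFiniteMeasure (volume.restrict Ω)] (hΩ : IsOpen Ω)
    {w : WAmbient N p Ω} (hw : w ∈ WSpace N p Ω) :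
    ∀ᵐ x ∂(volume.restrict Ω), w.1 x = 0 → w.2 x = 0 := by
  have hq : 1 ≤ ENNReal.ofReal p := Fact.out
  have hint : Integrable (fun x => (w.2 : EN N → EN N) x) (volume.restrict Ω) :=
    (Lp.memLp w.2).integrable hq
  have hu : Measurable (w.1 : EN N → ℝ) := (Lp.stronglyMeasurable w.1).measurable
  have hS : MeasurableSet {x | (w.1 : EN N → ℝ) x = 0} := hu (measurableSet_singleton 0)
  have main : ∀ v : EN N, ∀ᵐ x ∂(volume : Measure (EN N)), x ∈ Ω →
      indicator {x | (w.1 : EN N → ℝ) x = 0} (fun x => inner ℝ (w.2 x) v) x = 0 := by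
    intro v
    have hi : IntegrableOn
        (indicator {x | (w.1 : EN N → ℝ) x = 0} (fun x => inner ℝ (w.2 x) v)) Ω volume :=
      Integrable.indicator (hint.inner_const v) hS
    refine hΩ.ae_eq_zero_of_integral_contDiff_smul_eq_zero hi.locallyIntegrableOn ?_
    intro ζ hζ hζc hζs
    rw [← setIntegral_eq_integral_of_forall_compl_eq_zero (s := Ω)]
    swap
    · intro x hx
      have : ζ x = 0 := image_eq_zero_of_notMem_tsupport fun h => hx (hζs h)
      simp [this]
    obtain ⟨C, hC⟩ := hζc.exists_bound_of_continuous hζ.continuous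
    have hζm := hζ.continuous.measurable
    have hbd : ∀ (n : ℕ) (x : EN N),
        |1 / (1 + ((w.1 : EN N → ℝ) x / (1 / ((n : ℝ) + 1))) ^ 2) * ζ x| ≤ C := by
      intro n x
      rw [abs_mul]
      have h1 : |1 / (1 + ((w.1 : EN N → ℝ) x / (1 / ((n : ℝ) + 1))) ^ 2)| ≤ 1 := by
        rw [abs_of_nonneg (by positivity), div_le_one (by positivity)]
        linarith [sq_nonneg ((w.1 : EN N → ℝ) x / (1 / ((n : ℝ) + 1)))]
      calc _ ≤ 1 * |ζ x| := mul_le_mul_of_nonneg_right h1 (abs_nonneg _)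
        _ ≤ C := by rw [one_mul]; exact hC x
    have key := aux_lim (μ := volume.restrict Ω)
      (h := fun (n : ℕ) x => 1 / (1 + ((w.1 : EN N → ℝ) x / (1 / ((n : ℝ) + 1))) ^ 2) * ζ x)
      (h0 := fun x => indicator {x | (w.1 : EN N → ℝ) x = 0} (fun _ => 1) x * ζ x)
      (g := fun n x => inner ℝ (w.2 x) v) (g0 := fun x => inner ℝ (w.2 x) v) (C := C)
      (fun n => Measurable.aestronglyMeasurable (by fun_prop)) hbd ?_
      (fun n => hint.inner_const v) (hint.inner_const v) (by simp)
    · have hz : Tendsto (fun n : ℕ => 1 / ((n : ℝ) + 1) *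
          ∫ x, (Real.pi / 2) * ‖fderiv ℝ ζ x v‖) atTop (nhds 0) := by
        simpa using (tendsto_one_div_add_atTop_nhds_zero_nat (𝕜 := ℝ)).mul_const
          (∫ x, (Real.pi / 2) * ‖fderiv ℝ ζ x v‖)
      have hz2 := squeeze_zero_norm
        (f := fun n : ℕ => ∫ x in Ω, (1 / (1 + ((w.1 : EN N → ℝ) x / (1 / ((n : ℝ) + 1))) ^ 2) * ζ x) *
          inner ℝ ((w.2 : EN N → EN N) x) v)
        (fun n : ℕ => aux_bound hw hζ hζc hζs v (δ := 1 / ((n : ℝ) + 1)) (by positivity)) hz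
      refine Eq.trans ?_ (tendsto_nhds_unique key hz2)
      congr 1; ext x
      by_cases hx : (w.1 : EN N → ℝ) x = 0 <;> simp [indicator, hx]
    · refine Eventually.of_forall fun x => ?_
      refine Tendsto.mul_const _ ?_
      by_cases hx : (w.1 : EN N → ℝ) x = 0
      · simp [indicator, hx]
      · simp only [indicator, mem_ofPred_eq, hx, if_false]
        have ht : Tendsto (fun n : ℕ => 1 + ((w.1 : EN N → ℝ) x) ^ 2 * ((n : ℝ) + 1) ^ 2)
            atTop atTop := by
          refine tendsto_atTop_add_const_left _ _ (Tendsto.const_mul_atTop (by positivity) ?_)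
          refine (tendsto_pow_atTop two_ne_zero).comp ?_
          exact tendsto_atTop_add_const_right _ _ tendsto_natCast_atTop_atTop
        refine ht.inv_tendsto_atTop.congr fun n => ?_
        simp [mul_pow]
  have hall := ae_all_iff.2 fun i : Fin N => main (EuclideanSpace.single i 1)
  rw [ae_restrict_iff' hΩ.measurableSet]
  filter_upwards [hall] with x hx hxΩ hx0
  ext i
  have := hx i hxΩ
  simpa [indicator, hx0, EuclideanSpace.inner_single_right] using this

theorem aux_pow {E : Type*} [NormedAddCommGroup E] (a b : E) {p : ℝ} (hp : 1 < p) :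
    ‖a‖ ^ p ≤ 2 ^ p * (‖a - b‖ ^ p + ‖b‖ ^ p) := by
  have h0 : ‖a‖ ≤ 2 * max ‖a - b‖ ‖b‖ := by
    have : ‖a‖ ≤ ‖a - b‖ + ‖b‖ := by simpa using norm_add_le (a - b) b
    linarith [le_max_left ‖a - b‖ ‖b‖, le_max_right ‖a - b‖ ‖b‖]
  have h1 : 0 ≤ ‖a - b‖ ^ p := by positivity
  have h2 : 0 ≤ ‖b‖ ^ p := by positivity
  calc ‖a‖ ^ p ≤ (2 * max ‖a - b‖ ‖b‖) ^ p :=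
        Real.rpow_le_rpow (norm_nonneg _) h0 (by linarith)
    _ = 2 ^ p * (max ‖a - b‖ ‖b‖) ^ p := Real.mul_rpow (by norm_num) (by positivity)
    _ ≤ _ := by
      refine mul_le_mul_of_nonneg_left ?_ (by positivity)
      rcases max_choice ‖a - b‖ ‖b‖ with h | h <;> rw [h] <;> linarith

/-- Step (b) in the proof of Lemma 4.3. Assume `(H0)`, `(H2)`, `(H3)`
and let `K` be a compact subset of `W^{1,p}_0(Ω)`. Then for every `ε > 0` there exists
`R*_ε > 0` such that `|∫_Ω (A(x,Ru) − A^∞(x))|∇u|^p dx| < ε` for all `R ≥ R*_ε` and all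
`u ∈ K`. -/
theorem stmt_8 {N : ℕ} (hN : 2 ≤ N) (Ω : Set (EN N))
    (hΩopen : IsOpen Ω) (hΩconn : IsConnected Ω) (hΩbdd : Bornology.IsBounded Ω)
    (p : ℝ) (hp : 1 < p) [Fact (1 ≤ ENNReal.ofReal p)]
    (A At : EN N → ℝ → ℝ)
    (hAcar : Caratheodory Ω A) (hAtcar : Caratheodory Ω At)
    (hderiv : ∀ᵐ x ∂(volume.restrict Ω), ∀ t : ℝ, HasDerivAt (fun s => A x s) (At x t) t)
    -- (H0)
    (hH0A : H0bound Ω A) (hH0At : H0bound Ω At)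
    -- (H2)
    (Ainf : EN N → ℝ)
    (hAinfLinf : ∃ C : ℝ, ∀ᵐ x ∂(volume.restrict Ω), |Ainf x| ≤ C)
    (hH2 : ∀ ε > (0 : ℝ), ∃ R : ℝ, ∀ᵐ x ∂(volume.restrict Ω),
      ∀ t : ℝ, R ≤ |t| → |A x t - Ainf x| < ε)
    -- (H3)
    (hH3 : ∀ ε > (0 : ℝ), ∃ R : ℝ, ∀ᵐ x ∂(volume.restrict Ω),
      ∀ t : ℝ, R ≤ |t| → |At x t * t| < ε)
    (K : Set (WAmbient N p Ω)) (hKW : K ⊆ WSpace N p Ω) (hK : IsCompact K) :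
    ∀ ε > (0 : ℝ), ∃ Rstar > (0 : ℝ), ∀ R ≥ Rstar, ∀ w ∈ K,
      |∫ x in Ω, (A x (R * (⇑w.1 : EN N → ℝ) x) - Ainf x) *
          ‖(⇑w.2 : EN N → EN N) x‖ ^ p| < ε := by
  intro ε hε
  have hfin : IsFiniteMeasure (volume.restrict Ω) :=
    ⟨by rw [Measure.restrict_apply_univ]; exact hΩbdd.measure_lt_top⟩
  obtain ⟨C1, hC1⟩ := hAinfLinf
  obtain ⟨R1, hR1⟩ := hH2 1 one_pos
  obtain ⟨C0, hC0⟩ := hH0A (|R1| + 1) (by positivity)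
  set C : ℝ := 1 + |C0| + |C1| with hCdef
  have hCpos : 0 < C := by positivity
  have hAb : ∀ᵐ x ∂(volume.restrict Ω), ∀ t : ℝ, |A x t - Ainf x| ≤ C := by
    filter_upwards [hC1, hR1, hC0] with x h1 h2 h3 t
    by_cases ht : R1 ≤ |t|
    · have := h2 t ht
      have := abs_nonneg C0
      have := abs_nonneg C1
      linarith
    · have := h3 t (by linarith [le_abs_self R1, not_le.1 ht])
      have := abs_sub (A x t) (Ainf x)
      have := le_abs_self C0
      have := le_abs_self C1
      linarith
  by_contra hcon
  push Not at hcon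
  choose R hR W hWK hW using fun n : ℕ => hcon ((n : ℝ) + 1) (by positivity)
  obtain ⟨w, hwK, ms, hms, hlim⟩ := hK.tendsto_subseq hWK
  have hl1 : Tendsto (fun n => (W (ms n)).1) atTop (nhds w.1) :=
    (continuous_fst.tendsto w).comp hlim
  have hl2 : Tendsto (fun n => (W (ms n)).2) atTop (nhds w.2) :=
    (continuous_snd.tendsto w).comp hlim
  obtain ⟨ns, hns, hae⟩ := (tendstoInMeasure_of_tendsto_Lp hl1).exists_seq_tendsto_ae
  have hl2' := aux_Lp hp (hl2.comp hns.tendsto_atTop)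
  have hzero := aux_zero hΩopen (hKW hwK)
  have hp0 : 0 < p := by linarith
  have hintp : ∀ f : EN N → EN N, MemLp f (ENNReal.ofReal p) (volume.restrict Ω) →
      Integrable (fun x => ‖f x‖ ^ p) (volume.restrict Ω) := by
    intro f hf
    have := hf.integrable_norm_rpow (by simp; linarith) (by simp)
    rwa [ENNReal.toReal_ofReal hp0.le] at this
  have hRt : Tendsto (fun n => R (ms (ns n))) atTop atTop := by
    have h1 : Tendsto R atTop atTop :=
      tendsto_atTop_mono (fun n => by linarith [hR n]) tendsto_natCast_atTop_atTop
    exact h1.comp (hms.tendsto_atTop.comp hns.tendsto_atTop)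
  set S : ℝ := ∫ x in Ω, ‖(w.2 : EN N → EN N) x‖ ^ p with hS
  have hS0 : 0 ≤ S := integral_nonneg fun x => by positivity
  have claim : ∀ η > (0 : ℝ), ε ≤ 2 ^ p * (η * S) := by
    intro η hη
    obtain ⟨T, hT⟩ := hH2 η hη
    set s : ℕ → Set (EN N) := fun n =>
      {x | |R (ms (ns n)) * ((W (ms (ns n))).1 : EN N → ℝ) x| < T} with hs
    have hsm : ∀ n, MeasurableSet (s n) := by
      intro n
      have := (Lp.stronglyMeasurable (W (ms (ns n))).1).measurable
      exact measurableSet_lt (by fun_prop) measurable_const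
    have iD : ∀ n, Integrable (fun x => ‖((W (ms (ns n))).2 : EN N → EN N) x -
        (w.2 : EN N → EN N) x‖ ^ p) (volume.restrict Ω) := fun n =>
      hintp _ ((Lp.memLp _).sub (Lp.memLp _))
    have iG : Integrable (fun x => ‖(w.2 : EN N → EN N) x‖ ^ p) (volume.restrict Ω) :=
      hintp _ (Lp.memLp _)
    have iI : ∀ n, Integrable ((s n).indicator fun x => ‖(w.2 : EN N → EN N) x‖ ^ p)
        (volume.restrict Ω) := fun n => iG.indicator (hsm n)
    have lI : Tendsto (fun n => ∫ x in Ω, (s n).indicator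
        (fun x => ‖(w.2 : EN N → EN N) x‖ ^ p) x) atTop (nhds 0) := by
      have h0 : ∫ x in Ω, (0 : ℝ) = 0 := by simp
      rw [← h0]
      refine tendsto_integral_of_dominated_convergence _ (fun n => (iI n).1) iG
        (fun n => Eventually.of_forall fun x => ?_) ?_
      · refine (norm_indicator_le_norm_self _ _).trans ?_
        rw [Real.norm_of_nonneg (by positivity)]
      · filter_upwards [hzero, hae] with x hx hxl
        by_cases hx0 : (w.1 : EN N → ℝ) x = 0
        · have : ‖(w.2 : EN N → EN N) x‖ ^ p = 0 := by
            rw [hx hx0, norm_zero, Real.zero_rpow hp0.ne']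
          refine tendsto_const_nhds.congr fun n => ?_
          simp only [indicator]
          split_ifs <;> simp [this]
        · have ht : Tendsto (fun n => R (ms (ns n)) * |((W (ms (ns n))).1 : EN N → ℝ) x|)
              atTop atTop := hRt.atTop_mul_pos (abs_pos.2 hx0) hxl.abs
          refine tendsto_const_nhds.congr' ?_
          filter_upwards [ht.eventually_ge_atTop T, hRt.eventually_ge_atTop 0] with n hn hn2
          rw [indicator_of_notMem]
          simp only [hs, mem_ofPred_eq, not_lt]
          rwa [abs_mul, abs_of_nonneg hn2]
    have lT : Tendsto (fun n => 2 ^ p * (C * (∫ x in Ω, ‖((W (ms (ns n))).2 : EN N → EN N) x -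
        (w.2 : EN N → EN N) x‖ ^ p) + (η * S + C * ∫ x in Ω, (s n).indicator
        (fun x => ‖(w.2 : EN N → EN N) x‖ ^ p) x))) atTop
        (nhds (2 ^ p * (C * 0 + (η * S + C * 0)))) :=
      ((hl2'.const_mul C).add ((lI.const_mul C).const_add _)).const_mul _
    have : 2 ^ p * (η * S) = 2 ^ p * (C * 0 + (η * S + C * 0)) := by ring
    rw [this]
    refine ge_of_tendsto' lT fun n => (hW (ms (ns n))).trans ?_
    have iGI : Integrable (fun x => η * ‖(w.2 : EN N → EN N) x‖ ^ p +
        C * (s n).indicator (fun x => ‖(w.2 : EN N → EN N) x‖ ^ p) x) (volume.restrict Ω) :=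
      (iG.const_mul η).add ((iI n).const_mul C)
    rw [← Real.norm_eq_abs, hS, ← integral_const_mul, ← integral_const_mul, ← integral_const_mul,
      ← integral_add (iG.const_mul η) ((iI n).const_mul C),
      ← integral_add ((iD n).const_mul C) iGI,
      ← integral_const_mul]
    refine norm_integral_le_of_norm_le
      ((((iD n).const_mul C).add iGI).const_mul _) ?_
    filter_upwards [hAb, hT] with x h1 h2
    have g1 := aux_pow (((W (ms (ns n))).2 : EN N → EN N) x) ((w.2 : EN N → EN N) x) hp
    set a := |A x (R (ms (ns n)) * ((W (ms (ns n))).1 : EN N → ℝ) x) - Ainf x| with ha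
    have haC : a ≤ C := h1 _
    have ha0 : 0 ≤ a := abs_nonneg _
    set D := ‖((W (ms (ns n))).2 : EN N → EN N) x - (w.2 : EN N → EN N) x‖ ^ p with hD
    have hD0 : 0 ≤ D := by positivity
    have hG0 : 0 ≤ ‖(w.2 : EN N → EN N) x‖ ^ p := by positivity
    have hag : a * ‖(w.2 : EN N → EN N) x‖ ^ p ≤ η * ‖(w.2 : EN N → EN N) x‖ ^ p +
        C * (s n).indicator (fun x => ‖(w.2 : EN N → EN N) x‖ ^ p) x := by
      by_cases hx : x ∈ s n
      · rw [indicator_of_mem hx]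
        nlinarith [mul_le_mul_of_nonneg_right haC hG0, mul_nonneg hη.le hG0]
      · rw [indicator_of_notMem hx]
        have := (h2 _ (not_lt.1 hx)).le
        nlinarith [mul_le_mul_of_nonneg_right this hG0]
    rw [norm_mul, Real.norm_eq_abs, ← ha, Real.norm_of_nonneg (by positivity)]
    calc _ ≤ a * (2 ^ p * (D + ‖(w.2 : EN N → EN N) x‖ ^ p)) :=
          mul_le_mul_of_nonneg_left g1 ha0
      _ = 2 ^ p * (a * D + a * ‖(w.2 : EN N → EN N) x‖ ^ p) := by ring
      _ ≤ _ := by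
        refine mul_le_mul_of_nonneg_left ?_ (by positivity)
        exact add_le_add (mul_le_mul_of_nonneg_right haC hD0) hag
  have hP : 0 < 2 ^ p * S + 1 := by positivity
  have h := claim (ε / (2 * (2 ^ p * S + 1))) (by positivity)
  have h2 : 2 ^ p * (ε / (2 * (2 ^ p * S + 1)) * S) = ε / 2 * ((2 ^ p * S) / (2 ^ p * S + 1)) := by
    field_simp
  have h3 : (2 ^ p * S) / (2 ^ p * S + 1) ≤ 1 := by
    rw [div_le_one hP]; linarith
  rw [h2] at h
  nlinarith

end
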